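/- arXiv:1903.08738 — 5 statements merged into one kernel-verified Lean document; each statement's English description precedes it below -/
import Mathlib

section
/- Let m ≥ 1, B > 0, T ≥ 1, ω ≥ 0, ε_FQI ≥ 0, ε_FQE ≥ 0. Let Π be a nonempty set, C, Ĉ : Π → ℝ, G, Ĝ : Π → ℝ^m, τ ∈ ℝ^m, and π* ∈ Π with G(π*) ≤ τ componentwise. Suppose π_1,…,π_T ∈ Π and λ_1,…,λ_T ∈ ℝ^m satisfy, for every t: (i) λ_t ≥ 0 componentwise and Σ_i λ_t[i] ≤ B; (ii) approximate best response with respect to the true Lagrangian: C(π_t) + ⟨λ_t, G(π_t) − τ⟩ ≤ C(π*) + ⟨λ_t, G(π*) − τ⟩ + ε_FQI; (iii) evaluation accuracy: |Ĉ(π_t) − C(π_t)| ≤ ε_FQE and |Ĝ_i(π_t) − G_i(π_t)| ≤ ε_FQE for every coordinate i. Suppose also the no-regret property of the dual player: for every λ ∈ ℝ^m with λ ≥ 0 and Σ_i λ_i ≤ B, (1/T) Σ_t [Ĉ(π_t) + ⟨λ, Ĝ(π_t) − τ⟩] ≤ (1/T) Σ_t [Ĉ(π_t) + ⟨λ_t,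 Ĝ(π_t) − τ⟩] + ω. Then the averaged (mixture) policy satisfies (1/T) Σ_{t=1}^T C(π_t) ≤ C(π*) + ω + ε_FQI + (2 + B) ε_FQE. -/
/-- **Objective bound of the returned mixture policy** (deterministic core of Theorem 4).
Under approximate best responses (error `εFQI`), accurate off-policy evaluation
(error `εFQE`) and the no-regret property of the dual player (regret `ω`), the
average true objective value of the iterates is within
`ω + εFQI + (2 + B) εFQE` of the optimal feasible value `C πstar`. -/
theorem mixture_policy_objective_bound
    {Pol : Type*} [Nonempty Pol] (m : ℕ) (hm : 1 ≤ m)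
    (B : ℝ) (hB : 0 < B) (T : ℕ) (hT : 1 ≤ T)
    (ω εFQI εFQE : ℝ) (hω : 0 ≤ ω) (hεFQI : 0 ≤ εFQI) (hεFQE : 0 ≤ εFQE)
    (C Chat : Pol → ℝ) (G Ghat : Pol → Fin m → ℝ) (τ : Fin m → ℝ)
    (πstar : Pol) (hfeas : ∀ i, G πstar i ≤ τ i)
    (πs : Fin T → Pol) (lams : Fin T → Fin m → ℝ)
    (hlam : ∀ t : Fin T, (∀ i, 0 ≤ lams t i) ∧ ∑ i, lams t i ≤ B)
    (hbr : ∀ t : Fin T,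
      C (πs t) + ∑ i, lams t i * (G (πs t) i - τ i)
        ≤ C πstar + ∑ i, lams t i * (G πstar i - τ i) + εFQI)
    (hCeval : ∀ t : Fin T, |Chat (πs t) - C (πs t)| ≤ εFQE)
    (hGeval : ∀ (t : Fin T) (i : Fin m), |Ghat (πs t) i - G (πs t) i| ≤ εFQE)
    (hnr : ∀ lam : Fin m → ℝ, (∀ i, 0 ≤ lam i) → (∑ i, lam i ≤ B) →
      (1 / (T : ℝ)) * ∑ t, (Chat (πs t) + ∑ i, lam i * (Ghat (πs t) i - τ i))
        ≤ (1 / (T : ℝ)) * ∑ t, (Chat (πs t) + ∑ i, lams t i * (Ghat (πs t) i - τ i))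
          + ω) :
    (1 / (T : ℝ)) * ∑ t, C (πs t) ≤ C πstar + ω + εFQI + (2 + B) * εFQE := by
  have hiter (t : Fin T) : C (πs t) + ∑ i, lams t i * (Ghat (πs t) i - τ i)
      ≤ C πstar + εFQI + B * εFQE := by
    obtain ⟨hnonneg, hsum⟩ := hlam t
    have hstar : ∑ i, lams t i * (G πstar i - τ i) ≤ 0 :=
      Finset.sum_nonpos fun i _ =>
        mul_nonpos_of_nonneg_of_nonpos (hnonneg i) (sub_nonpos.2 (hfeas i))
    have herr : ∑ i, lams t i * (Ghat (πs t) i - τ i)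
        ≤ ∑ i, lams t i * (G (πs t) i - τ i) + B * εFQE := by
      calc ∑ i, lams t i * (Ghat (πs t) i - τ i)
          ≤ ∑ i, (lams t i * (G (πs t) i - τ i) + lams t i * εFQE) := by
            refine Finset.sum_le_sum fun i _ => ?_
            rw [← mul_add]
            refine mul_le_mul_of_nonneg_left ?_ (hnonneg i)
            linarith [le_of_abs_le (hGeval t i)]
        _ ≤ ∑ i, lams t i * (G (πs t) i - τ i) + B * εFQE := by
            rw [Finset.sum_add_distrib, ← Finset.sum_mul]
            gcongr
    linarith [hbr t]
  have hTpos : (0 : ℝ) < T := by exact_mod_cast hT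
  have hmean : (1 / (T : ℝ)) * ∑ t, (C (πs t) + ∑ i, lams t i * (Ghat (πs t) i - τ i))
      ≤ C πstar + εFQI + B * εFQE := by
    rw [one_div, inv_mul_le_iff₀ hTpos]
    simpa [mul_add] using Finset.sum_le_sum fun t (_ : t ∈ Finset.univ) => hiter t
  have hzero := hnr 0 (fun _ => le_rfl) (by simpa using hB.le)
  simp only [Pi.zero_apply, zero_mul, Finset.sum_const_zero, add_zero] at hzero
  rw [Finset.sum_add_distrib, mul_add] at hmean hzero
  linarith
end

section
/- Let (Ω, F, μ) be a probability space, C̄ > 0, and let U, M, Y : Ω → ℝ be random variables with |U| ≤ C̄, |M| ≤ C̄ and |Y| ≤ C̄ almost surely, satisfying the orthogonality property E[(U − M)(M − Y)] = 0. Define h := (U − Y)² − (M − Y)². Then: (i) E[h] = E[(U − M)²], so in particular E[h] ≥ 0; and (ii) E[h²] ≤ 16 C̄² E[h]; consequently Var(h) ≤ 16 C̄² E[h]. -/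
open MeasureTheory ProbabilityTheory

/-- **Variance-control lemma for the excess squared loss.**
If `U`, `M`, `Y` are bounded by `C̄` and satisfy the orthogonality property
`E[(U − M)(M − Y)] = 0` (as when `M` is the regression function `E[Y | X, A]`),
then `h := (U − Y)² − (M − Y)²` satisfies `E[h] = E[(U − M)²] ≥ 0`,
`E[h²] ≤ 16 C̄² E[h]`, and hence `Var(h) ≤ 16 C̄² E[h]`. -/
theorem excess_loss_variance_control
    {Ω : Type*} [MeasurableSpace Ω] (μ : Measure Ω) [IsProbabilityMeasure μ]
    (Cbar : ℝ) (hCbar : 0 < Cbar)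
    (U M Y : Ω → ℝ) (hU : Measurable U) (hM : Measurable M) (hY : Measurable Y)
    (hUb : ∀ᵐ ω ∂μ, |U ω| ≤ Cbar)
    (hMb : ∀ᵐ ω ∂μ, |M ω| ≤ Cbar)
    (hYb : ∀ᵐ ω ∂μ, |Y ω| ≤ Cbar)
    (horth : ∫ ω, (U ω - M ω) * (M ω - Y ω) ∂μ = 0) :
    (∫ ω, ((U ω - Y ω) ^ 2 - (M ω - Y ω) ^ 2) ∂μ = ∫ ω, (U ω - M ω) ^ 2 ∂μ) ∧
    (0 ≤ ∫ ω, ((U ω - Y ω) ^ 2 - (M ω - Y ω) ^ 2) ∂μ) ∧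
    (∫ ω, ((U ω - Y ω) ^ 2 - (M ω - Y ω) ^ 2) ^ 2 ∂μ
      ≤ 16 * Cbar ^ 2 * ∫ ω, ((U ω - Y ω) ^ 2 - (M ω - Y ω) ^ 2) ∂μ) ∧
    (variance (fun ω => (U ω - Y ω) ^ 2 - (M ω - Y ω) ^ 2) μ
      ≤ 16 * Cbar ^ 2 * ∫ ω, ((U ω - Y ω) ^ 2 - (M ω - Y ω) ^ 2) ∂μ) := by
  have hD : ∀ᵐ ω ∂μ, |U ω - M ω| ≤ 2 * Cbar := by
    filter_upwards [hUb, hMb] with ω h₁ h₂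
    exact (abs_sub _ _).trans (by linarith)
  have hR : ∀ᵐ ω ∂μ, |M ω - Y ω| ≤ 2 * Cbar := by
    filter_upwards [hMb, hYb] with ω h₁ h₂
    exact (abs_sub _ _).trans (by linarith)
  have int_sq : Integrable (fun ω => (U ω - M ω) ^ 2) μ := by
    refine Integrable.of_bound (by fun_prop) ((2 * Cbar) ^ 2) ?_
    filter_upwards [hD] with ω h
    rw [Real.norm_eq_abs, abs_pow]
    gcongr
  have int_cross : Integrable (fun ω => (U ω - M ω) * (M ω - Y ω)) μ := by
    refine Integrable.of_bound (by fun_prop) ((2 * Cbar) * (2 * Cbar)) ?_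
    filter_upwards [hD, hR] with ω h₁ h₂
    rw [Real.norm_eq_abs, abs_mul]
    gcongr
  have mean_eq : ∫ ω, ((U ω - Y ω) ^ 2 - (M ω - Y ω) ^ 2) ∂μ = ∫ ω, (U ω - M ω) ^ 2 ∂μ := by
    calc ∫ ω, ((U ω - Y ω) ^ 2 - (M ω - Y ω) ^ 2) ∂μ
        = ∫ ω, ((U ω - M ω) ^ 2 + 2 * ((U ω - M ω) * (M ω - Y ω))) ∂μ := by
          congr 1 with ω
          ring
      _ = ∫ ω, (U ω - M ω) ^ 2 ∂μ := by
          rw [integral_add int_sq (int_cross.const_mul 2), integral_const_mul, horth, mul_zero,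
            add_zero]
  have second_moment_le : ∫ ω, ((U ω - Y ω) ^ 2 - (M ω - Y ω) ^ 2) ^ 2 ∂μ
      ≤ 16 * Cbar ^ 2 * ∫ ω, ((U ω - Y ω) ^ 2 - (M ω - Y ω) ^ 2) ∂μ := by
    rw [mean_eq, ← integral_const_mul]
    refine integral_mono_of_nonneg (ae_of_all _ fun ω => sq_nonneg _) (int_sq.const_mul _) ?_
    filter_upwards [hUb, hMb, hYb] with ω h₁ h₂ h₃
    rw [abs_le] at h₁ h₂ h₃
    have hS : (U ω + M ω - 2 * Y ω) ^ 2 ≤ (4 * Cbar) ^ 2 :=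
      sq_le_sq' (by linarith) (by linarith)
    calc ((U ω - Y ω) ^ 2 - (M ω - Y ω) ^ 2) ^ 2
        = (U ω + M ω - 2 * Y ω) ^ 2 * (U ω - M ω) ^ 2 := by ring
      _ ≤ (4 * Cbar) ^ 2 * (U ω - M ω) ^ 2 := by gcongr
      _ = 16 * Cbar ^ 2 * (U ω - M ω) ^ 2 := by ring
  refine ⟨mean_eq, mean_eq ▸ integral_nonneg fun ω => sq_nonneg _, second_moment_le, ?_⟩
  exact (variance_le_expectation_sq (by fun_prop)).trans second_moment_le
end

section
/- Consider a finite Markov decision process with state set S, action set A, transition probabilities p, cost c and discount γ ∈ (0,1). Let Q* : S × A → ℝ satisfy T Q* = Q*, and let π* : S → A be greedy with respect to Q*. Let K ≥ 1, let Q_0, …, Q_K : S × A → ℝ be arbitrary, and set ε_k := T Q_k − Q_{k+1} for k = 0, …, K−1. Then pointwise on S × A: Q* − Q_K ≥ Σ_{k=0}^{K−1} γ^{K−1−k} (P^{π*})^{K−1−k}(ε_k) + γ^K (P^{π*})^K (Q* − Q_0). -/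
open Finset

/-- The transition operator `P^π` of a deterministic policy `π` in a finite MDP:
`(P^π f)(s,a) = Σ_{s'} p(s,a,s') f(s', π(s'))`. -/
noncomputable def Pop {S A : Type*} [Fintype S]
    (p : S → A → S → ℝ) (π : S → A) (f : S → A → ℝ) : S → A → ℝ :=
  fun s a => ∑ s', p s a s' * f s' (π s')

/-- The Bellman optimality operator:
`(T f)(s,a) = c(s,a) + γ Σ_{s'} p(s,a,s') min_{a'} f(s',a')`. -/
noncomputable def bellmanOpt {S A : Type*} [Fintype S] [Fintype A] [Nonempty A]
    (p : S → A → S → ℝ) (c : S → A → ℝ) (γ : ℝ) (f : S → A → ℝ) : S → A → ℝ :=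
  fun s a => c s a + γ * ∑ s', p s a s' * (univ.inf' univ_nonempty (f s'))

/-- The discounted transition operator `γ P^π` as a linear map. -/
noncomputable def discountedPop {S A : Type*} [Fintype S]
    (p : S → A → S → ℝ) (π : S → A) (γ : ℝ) : Module.End ℝ (S → A → ℝ) :=
  γ • { toFun := Pop p π
        map_add' := fun f g => by
          funext s a
          simp [Pop, mul_add, sum_add_distrib]
        map_smul' := fun r f => by
          funext s a
          simp [Pop, mul_sum, mul_left_comm] }

theorem discountedPop_apply {S A : Type*} [Fintype S]
    (p : S → A → S → ℝ) (π : S → A) (γ : ℝ) (f : S → A → ℝ) :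
    discountedPop p π γ f = γ • Pop p π f := rfl

theorem discountedPop_pow_apply {S A : Type*} [Fintype S]
    (p : S → A → S → ℝ) (π : S → A) (γ : ℝ) (n : ℕ) (f : S → A → ℝ) :
    (discountedPop p π γ ^ n) f = γ ^ n • (Pop p π)^[n] f := by
  rw [discountedPop, smul_pow, LinearMap.smul_apply, Module.End.pow_apply]
  rfl

theorem discountedPop_monotone {S A : Type*} [Fintype S]
    {p : S → A → S → ℝ} (hp : ∀ s a s', 0 ≤ p s a s') (π : S → A) {γ : ℝ} (hγ : 0 ≤ γ) :
    Monotone (discountedPop p π γ) := fun _ _ hfg s a =>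
  mul_le_mul_of_nonneg_left
    (sum_le_sum fun s' _ => mul_le_mul_of_nonneg_left (hfg s' (π s')) (hp s a s')) hγ

/-- If `π` is greedy for `f`, then `γ P^π (f - g) ≤ T f - T g`. -/
theorem discountedPop_sub_le_bellmanOpt_sub {S A : Type*} [Fintype S] [Fintype A] [Nonempty A]
    {p : S → A → S → ℝ} (hp : ∀ s a s', 0 ≤ p s a s') (c : S → A → ℝ) {γ : ℝ} (hγ : 0 ≤ γ)
    {π : S → A} {f : S → A → ℝ} (hf : ∀ s, f s (π s) = univ.inf' univ_nonempty (f s))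
    (g : S → A → ℝ) :
    discountedPop p π γ (f - g) ≤ bellmanOpt p c γ f - bellmanOpt p c γ g := by
  intro s a
  simp only [discountedPop_apply, Pop, bellmanOpt, Pi.smul_apply, Pi.sub_apply, smul_eq_mul,
    add_sub_add_left_eq_sub, ← mul_sub, ← sum_sub_distrib, ← hf]
  exact mul_le_mul_of_nonneg_left (sum_le_sum fun s' _ => mul_le_mul_of_nonneg_left
    (sub_le_sub_left (inf'_le _ (mem_univ _)) _) (hp s a s')) hγ

/-- Unrolling the linear recursion `M (D k) + e k ≤ D (k + 1)` for a monotone `M`. -/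
theorem sum_pow_add_pow_le_of_recursion {R E : Type*} [Semiring R] [AddCommGroup E]
    [PartialOrder E] [IsOrderedAddMonoid E] [Module R E] {M : Module.End R E} (hM : Monotone M)
    {D e : ℕ → E} (h : ∀ k, M (D k) + e k ≤ D (k + 1)) (n : ℕ) :
    ∑ k ∈ range n, (M ^ (n - 1 - k)) (e k) + (M ^ n) (D 0) ≤ D n := by
  induction n with
  | zero => simp
  | succ n ih =>
    refine le_trans (le_of_eq ?_) ((add_le_add_left (hM ih) (e n)).trans (h n))
    have hsum : ∑ k ∈ range n, (M ^ (n - k)) (e k)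
        = M (∑ k ∈ range n, (M ^ (n - 1 - k)) (e k)) := by
      rw [map_sum]
      refine sum_congr rfl fun k hk => ?_
      have hk' : n - k = n - 1 - k + 1 := by
        have := mem_range.mp hk
        omega
      rw [hk', pow_succ', Module.End.mul_apply]
    rw [sum_range_succ, map_add, ← hsum, pow_succ' M n, Module.End.mul_apply]
    simp only [Nat.add_sub_cancel, Nat.sub_self, pow_zero, Module.End.one_apply]
    abel

/-- **Step 1 of the FQI error-propagation analysis**: the lower-bound recursion through
the optimal policy `π*`. Pointwise on `S × A`,
`Q* − Q_K ≥ Σ_{k<K} γ^{K−1−k} (P^{π*})^{K−1−k}(ε_k) + γ^K (P^{π*})^K (Q* − Q_0)`. -/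
theorem fqi_error_propagation_optimal_policy
    {S A : Type*} [Fintype S] [Fintype A] [Nonempty S] [Nonempty A]
    (p : S → A → S → ℝ) (hp : ∀ s a s', 0 ≤ p s a s')
    (hpsum : ∀ s a, ∑ s', p s a s' = 1)
    (c : S → A → ℝ) (γ : ℝ) (hγ : γ ∈ Set.Ioo (0 : ℝ) 1)
    (Qstar : S → A → ℝ) (hQstar : bellmanOpt p c γ Qstar = Qstar)
    (πstar : S → A)
    (hgreedy : ∀ s, Qstar s (πstar s) = univ.inf' univ_nonempty (Qstar s))
    (K : ℕ) (hK : 1 ≤ K) (Qs : ℕ → S → A → ℝ)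
    (eps : ℕ → S → A → ℝ)
    (heps : ∀ k, eps k = bellmanOpt p c γ (Qs k) - Qs (k + 1)) :
    ∀ s a,
      (∑ k ∈ Finset.range K, γ ^ (K - 1 - k) • (Pop p πstar)^[K - 1 - k] (eps k)) s a
        + γ ^ K • ((Pop p πstar)^[K] (Qstar - Qs 0)) s a
      ≤ Qstar s a - Qs K s a := by
  have h := sum_pow_add_pow_le_of_recursion
    (discountedPop_monotone hp πstar hγ.1.le) (D := fun k => Qstar - Qs k) (e := eps)
    (fun k => by
      have hk := discountedPop_sub_le_bellmanOpt_sub hp c hγ.1.le hgreedy (Qs k)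
      rw [hQstar] at hk
      refine (add_le_add_left hk (eps k)).trans (le_of_eq ?_)
      rw [heps]
      abel) K
  simp only [discountedPop_pow_apply] at h
  exact fun s a => h s a
end

section
/- Consider a finite Markov decision process with state set S, action set A, transition probabilities p, cost c and discount γ ∈ (0,1). Let Q* : S × A → ℝ satisfy T Q* = Q*. Let K ≥ 1, let Q_0, …, Q_K : S × A → ℝ be arbitrary, set ε_k := T Q_k − Q_{k+1} for k = 0, …, K−1, and for each k let π_k : S → A be greedy with respect to Q_k. Then pointwise on S × A: Q* − Q_K ≤ Σ_{k=0}^{K−1} γ^{K−1−k} (P^{π_{K−1}} ∘ P^{π_{K−2}} ∘ ⋯ ∘ P^{π_{k+1}})(ε_k) + γ^K (P^{π_{K−1}} ∘ ⋯ ∘ P^{π_0})(Q* − Q_0), where the composition appearing with ε_{K−1} is the identity. -/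
open Finset

/-- `PopChain p πs i n f = P^{π_{i+n-1}} ∘ ⋯ ∘ P^{π_i}` applied to `f`
(the identity for `n = 0`). -/
noncomputable def PopChain {S A : Type*} [Fintype S]
    (p : S → A → S → ℝ) (πs : ℕ → S → A) (i : ℕ) : ℕ → (S → A → ℝ) → (S → A → ℝ)
  | 0 => id
  | n + 1 => fun f => Pop p (πs (i + n)) (PopChain p πs i n f)

/-- `P^π` is monotone when `p` is nonnegative. -/
theorem Pop_mono {S A : Type*} [Fintype S] {p : S → A → S → ℝ}
    (hp : ∀ s a s', 0 ≤ p s a s') (π : S → A) {f g : S → A → ℝ}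
    (hfg : ∀ s a, f s a ≤ g s a) (s : S) (a : A) : Pop p π f s a ≤ Pop p π g s a :=
  Finset.sum_le_sum fun s' _ => mul_le_mul_of_nonneg_left (hfg s' (π s')) (hp s a s')

/-- `P^π` as a linear map. -/
noncomputable def popLinear {S A : Type*} [Fintype S] (p : S → A → S → ℝ) (π : S → A) :
    (S → A → ℝ) →ₗ[ℝ] (S → A → ℝ) where
  toFun := Pop p π
  map_add' f g := by
    funext s a
    simp [Pop, mul_add, Finset.sum_add_distrib]
  map_smul' r f := by
    funext s a
    simp [Pop, Finset.mul_sum, mul_left_comm]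

/-- `T f - T g ≤ γ P^π (f - g)` when `π` is greedy with respect to `g`. -/
theorem bellmanOpt_sub_le_Pop {S A : Type*} [Fintype S] [Fintype A] [Nonempty A]
    {p : S → A → S → ℝ} (hp : ∀ s a s', 0 ≤ p s a s') (c : S → A → ℝ) {γ : ℝ} (hγ : 0 ≤ γ)
    (f : S → A → ℝ) {g : S → A → ℝ} {π : S → A}
    (hπ : ∀ s, g s (π s) = univ.inf' univ_nonempty (g s)) (s : S) (a : A) :
    bellmanOpt p c γ f s a - bellmanOpt p c γ g s a ≤ γ * Pop p π (f - g) s a := by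
  simp only [bellmanOpt, Pop, add_sub_add_left_eq_sub, ← mul_sub, ← Finset.sum_sub_distrib]
  refine mul_le_mul_of_nonneg_left (Finset.sum_le_sum fun s' _ =>
    mul_le_mul_of_nonneg_left ?_ (hp s a s')) hγ
  rw [← hπ s']
  exact sub_le_sub_right (Finset.inf'_le _ (mem_univ _)) _

/-- Unrolling of the affine recursion `B (n + 1) = γ P^{π_n} (B n) + e n`, `B 0 = f`. -/
theorem sum_PopChain_succ {S A : Type*} [Fintype S] (p : S → A → S → ℝ) (γ : ℝ)
    (πs : ℕ → S → A) (e : ℕ → S → A → ℝ) (f : S → A → ℝ) (n : ℕ) :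
    (∑ k ∈ Finset.range (n + 1), γ ^ (n - k) • PopChain p πs (k + 1) (n - k) (e k))
        + γ ^ (n + 1) • PopChain p πs 0 (n + 1) f
      = γ • Pop p (πs n) ((∑ k ∈ Finset.range n,
            γ ^ (n - 1 - k) • PopChain p πs (k + 1) (n - 1 - k) (e k))
          + γ ^ n • PopChain p πs 0 n f) + e n := by
  have hchain : ∀ k ∈ Finset.range n,
      γ ^ (n - k) • PopChain p πs (k + 1) (n - k) (e k)
        = γ • popLinear p (πs n)
            (γ ^ (n - 1 - k) • PopChain p πs (k + 1) (n - 1 - k) (e k)) := by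
    intro k hk
    obtain ⟨m, rfl⟩ := Nat.exists_eq_add_of_lt (Finset.mem_range.mp hk)
    have h₁ : k + m + 1 - k = m + 1 := by omega
    have h₂ : k + m + 1 - 1 - k = m := by omega
    rw [h₁, h₂, map_smul, smul_smul, ← pow_succ']
    change _ • Pop p (πs (k + 1 + m)) _ = _ • Pop p (πs (k + m + 1)) _
    rw [Nat.add_right_comm]
  have hlast : γ ^ (n + 1) • PopChain p πs 0 (n + 1) f
      = γ • popLinear p (πs n) (γ ^ n • PopChain p πs 0 n f) := by
    rw [map_smul, smul_smul, ← pow_succ']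
    change _ • Pop p (πs (0 + n)) _ = _ • Pop p (πs n) _
    rw [Nat.zero_add]
  change _ = γ • popLinear p (πs n) _ + _
  rw [Finset.sum_range_succ, Finset.sum_congr rfl hchain, hlast, map_add, map_sum, smul_add,
    Finset.smul_sum, Nat.sub_self, pow_zero, one_smul]
  simp only [PopChain, id]
  abel

/-- **Step 2 of the FQI error-propagation analysis**: the upper-bound recursion through
the greedy iterate policies `π_k`. Pointwise on `S × A`,
`Q* − Q_K ≤ Σ_{k<K} γ^{K−1−k} (P^{π_{K−1}} ⋯ P^{π_{k+1}})(ε_k)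
            + γ^K (P^{π_{K−1}} ⋯ P^{π_0})(Q* − Q_0)`,
where the composition appearing with `ε_{K−1}` is the identity. -/
theorem fqi_error_propagation_greedy_policies
    {S A : Type*} [Fintype S] [Fintype A] [Nonempty S] [Nonempty A]
    (p : S → A → S → ℝ) (hp : ∀ s a s', 0 ≤ p s a s')
    (hpsum : ∀ s a, ∑ s', p s a s' = 1)
    (c : S → A → ℝ) (γ : ℝ) (hγ : γ ∈ Set.Ioo (0 : ℝ) 1)
    (Qstar : S → A → ℝ) (hQstar : bellmanOpt p c γ Qstar = Qstar)
    (K : ℕ) (hK : 1 ≤ K) (Qs : ℕ → S → A → ℝ)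
    (eps : ℕ → S → A → ℝ)
    (heps : ∀ k, eps k = bellmanOpt p c γ (Qs k) - Qs (k + 1))
    (πs : ℕ → S → A)
    (hgreedy : ∀ k s, Qs k s (πs k s) = univ.inf' univ_nonempty (Qs k s)) :
    ∀ s a,
      Qstar s a - Qs K s a
        ≤ (∑ k ∈ Finset.range K,
              γ ^ (K - 1 - k) • PopChain p πs (k + 1) (K - 1 - k) (eps k)) s a
          + γ ^ K • PopChain p πs 0 K (Qstar - Qs 0) s a := by
  clear hK
  induction K with
  | zero => simp [PopChain]
  | succ n ih =>
    intro s a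
    have hstep := bellmanOpt_sub_le_Pop hp c hγ.1.le Qstar (hgreedy n) s a
    have hmono := mul_le_mul_of_nonneg_left
      (Pop_mono hp (πs n) (f := Qstar - Qs n) (g := (∑ k ∈ Finset.range n,
          γ ^ (n - 1 - k) • PopChain p πs (k + 1) (n - 1 - k) (eps k))
        + γ ^ n • PopChain p πs 0 n (Qstar - Qs 0)) ih s a) hγ.1.le
    have hrec := congrFun (congrFun (sum_PopChain_succ p γ πs eps (Qstar - Qs 0) n) s) a
    have he := congrFun (congrFun (heps n) s) a
    rw [hQstar] at hstep
    simp only [Pi.add_apply, Pi.sub_apply, Pi.smul_apply, smul_eq_mul,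
      Nat.add_sub_cancel] at hrec he ⊢
    linarith
end

section
/- Consider a finite Markov decision process with state set S, action set A, transition probabilities p, cost c and discount γ ∈ (0,1). Let Q* : S × A → ℝ satisfy T Q* = Q*, let K ≥ 1 and Q_0, …, Q_K : S × A → ℝ with ‖T Q_k − Q_{k+1}‖_∞ ≤ ε for every k = 0, …, K−1, where ‖·‖_∞ is the supremum norm on functions S × A → ℝ. Let π_K : S → A be greedy with respect to Q_K and let Q^{π_K} satisfy T^{π_K} Q^{π_K} = Q^{π_K}. Then ‖Q^{π_K} − Q*‖_∞ ≤ (2γ/(1−γ)²) · ε + (2γ^{K+1}/(1−γ)) · ‖Q* − Q_0‖_∞. -/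
open Finset

/-- The Bellman evaluation operator of a policy `π`:
`(T^π f)(s,a) = c(s,a) + γ (P^π f)(s,a)`. -/
noncomputable def bellmanEval {S A : Type*} [Fintype S]
    (p : S → A → S → ℝ) (c : S → A → ℝ) (γ : ℝ) (π : S → A)
    (f : S → A → ℝ) : S → A → ℝ :=
  fun s a => c s a + γ * Pop p π f s a

section BellmanContraction

variable {S A : Type*} [Fintype S] [Fintype A]

lemma abs_apply_sub_apply_le_norm_sub (f g : S → A → ℝ) (s : S) (a : A) :
    |f s a - g s a| ≤ ‖f - g‖ :=
  (norm_le_pi_norm ((f - g) s) a).trans (norm_le_pi_norm (f - g) s)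

lemma abs_inf'_sub_inf'_le [Nonempty A] {u v : A → ℝ} {M : ℝ}
    (h : ∀ a, |u a - v a| ≤ M) :
    |univ.inf' univ_nonempty u - univ.inf' univ_nonempty v| ≤ M := by
  obtain ⟨a, -, ha⟩ := exists_mem_eq_inf' univ_nonempty u
  obtain ⟨b, -, hb⟩ := exists_mem_eq_inf' univ_nonempty v
  have hua := inf'_le u (mem_univ b)
  have hvb := inf'_le v (mem_univ a)
  have h₁ := abs_le.mp (h a)
  have h₂ := abs_le.mp (h b)
  rw [abs_le]
  constructor <;> linarith

/-- One-step discounted backups of state values are `γ`-Lipschitz in the supremum norm. -/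
lemma norm_backup_sub_backup_le {p : S → A → S → ℝ} (hp : ∀ s a s', 0 ≤ p s a s')
    (hpsum : ∀ s a, ∑ s', p s a s' = 1) (c : S → A → ℝ) {γ : ℝ} (hγ : 0 ≤ γ)
    {u v : S → ℝ} {M : ℝ} (hM : 0 ≤ M) (h : ∀ s, |u s - v s| ≤ M) :
    ‖(fun s a => c s a + γ * ∑ s', p s a s' * u s')
        - fun s a => c s a + γ * ∑ s', p s a s' * v s'‖ ≤ γ * M := by
  have hγM : 0 ≤ γ * M := mul_nonneg hγ hM
  refine (pi_norm_le_iff_of_nonneg hγM).2 fun s => (pi_norm_le_iff_of_nonneg hγM).2 fun a => ?_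
  have hsum : |∑ s', p s a s' * (u s' - v s')| ≤ M := calc
    _ ≤ ∑ s', |p s a s' * (u s' - v s')| := abs_sum_le_sum_abs _ _
    _ ≤ ∑ s', p s a s' * M := by
      refine sum_le_sum fun s' _ => ?_
      rw [abs_mul, abs_of_nonneg (hp s a s')]
      exact mul_le_mul_of_nonneg_left (h s') (hp s a s')
    _ = M := by rw [← sum_mul, hpsum, one_mul]
  have heq : c s a + γ * ∑ s', p s a s' * u s' - (c s a + γ * ∑ s', p s a s' * v s')
      = γ * ∑ s', p s a s' * (u s' - v s') := by
    simp only [mul_sub, sum_sub_distrib]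
    ring
  change |c s a + γ * ∑ s', p s a s' * u s' - (c s a + γ * ∑ s', p s a s' * v s')| ≤ γ * M
  rw [heq, abs_mul, abs_of_nonneg hγ]
  exact mul_le_mul_of_nonneg_left hsum hγ

lemma norm_bellmanOpt_sub_le [Nonempty A] {p : S → A → S → ℝ} (hp : ∀ s a s', 0 ≤ p s a s')
    (hpsum : ∀ s a, ∑ s', p s a s' = 1) (c : S → A → ℝ) {γ : ℝ} (hγ : 0 ≤ γ)
    (f g : S → A → ℝ) :
    ‖bellmanOpt p c γ f - bellmanOpt p c γ g‖ ≤ γ * ‖f - g‖ :=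
  norm_backup_sub_backup_le hp hpsum c hγ (norm_nonneg _) fun s =>
    abs_inf'_sub_inf'_le fun a => abs_apply_sub_apply_le_norm_sub f g s a

lemma norm_bellmanEval_sub_le {p : S → A → S → ℝ} (hp : ∀ s a s', 0 ≤ p s a s')
    (hpsum : ∀ s a, ∑ s', p s a s' = 1) (c : S → A → ℝ) {γ : ℝ} (hγ : 0 ≤ γ)
    (π : S → A) (f g : S → A → ℝ) :
    ‖bellmanEval p c γ π f - bellmanEval p c γ π g‖ ≤ γ * ‖f - g‖ :=
  norm_backup_sub_backup_le hp hpsum c hγ (norm_nonneg _) fun s =>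
    abs_apply_sub_apply_le_norm_sub f g s (π s)

lemma bellmanEval_eq_bellmanOpt_of_greedy [Nonempty A] (p : S → A → S → ℝ) (c : S → A → ℝ)
    (γ : ℝ) {π : S → A} {f : S → A → ℝ}
    (h : ∀ s, f s (π s) = univ.inf' univ_nonempty (f s)) :
    bellmanEval p c γ π f = bellmanOpt p c γ f := by
  unfold bellmanEval Pop bellmanOpt
  simp only [h]

end BellmanContraction

/-- A discrete Grönwall bound for affine contractions. -/
lemma le_pow_mul_add_div_of_le_mul_add {e : ℕ → ℝ} {γ ε : ℝ} (hγ₀ : 0 ≤ γ) (hγ₁ : γ < 1)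
    (hε : 0 ≤ ε) {K : ℕ} (h : ∀ k < K, e (k + 1) ≤ γ * e k + ε) :
    ∀ k ≤ K, e k ≤ γ ^ k * e 0 + ε / (1 - γ) := by
  have h₁ : 0 < 1 - γ := sub_pos.2 hγ₁
  intro k
  induction k with
  | zero =>
    intro _
    have := div_nonneg hε h₁.le
    simpa using this
  | succ k ih =>
    intro hk
    calc e (k + 1) ≤ γ * e k + ε := h k hk
      _ ≤ γ * (γ ^ k * e 0 + ε / (1 - γ)) + ε := by
        gcongr
        exact ih (by omega)
      _ = γ ^ (k + 1) * e 0 + ε / (1 - γ) := by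
        field_simp
        ring

/-- **Supremum-norm consequence of the FQI error-propagation analysis**:
if each fitted iterate has per-iteration error at most `ε` in sup norm, then the value
of the greedy policy `π_K` with respect to `Q_K` satisfies
`‖Q^{π_K} − Q*‖_∞ ≤ (2γ/(1−γ)²) ε + (2γ^{K+1}/(1−γ)) ‖Q* − Q_0‖_∞`. -/
theorem fqi_sup_norm_error_bound
    {S A : Type*} [Fintype S] [Fintype A] [Nonempty S] [Nonempty A]
    (p : S → A → S → ℝ) (hp : ∀ s a s', 0 ≤ p s a s')
    (hpsum : ∀ s a, ∑ s', p s a s' = 1)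
    (c : S → A → ℝ) (γ : ℝ) (hγ : γ ∈ Set.Ioo (0 : ℝ) 1)
    (Qstar : S → A → ℝ) (hQstar : bellmanOpt p c γ Qstar = Qstar)
    (K : ℕ) (hK : 1 ≤ K) (Qs : ℕ → S → A → ℝ) (ε : ℝ)
    (hε : ∀ k < K, ‖bellmanOpt p c γ (Qs k) - Qs (k + 1)‖ ≤ ε)
    (πK : S → A)
    (hgreedyK : ∀ s, Qs K s (πK s) = univ.inf' univ_nonempty (Qs K s))
    (QpiK : S → A → ℝ) (hQpiK : bellmanEval p c γ πK QpiK = QpiK) :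
    ‖QpiK - Qstar‖
      ≤ (2 * γ / (1 - γ) ^ 2) * ε
        + (2 * γ ^ (K + 1) / (1 - γ)) * ‖Qstar - Qs 0‖ := by
  obtain ⟨hγ₀, hγ₁⟩ := hγ
  have h₁ : 0 < 1 - γ := sub_pos.2 hγ₁
  have hε₀ : 0 ≤ ε := (norm_nonneg _).trans (hε 0 hK)
  have hstep : ∀ k < K, ‖Qstar - Qs (k + 1)‖ ≤ γ * ‖Qstar - Qs k‖ + ε := fun k hk => calc
    ‖Qstar - Qs (k + 1)‖
        ≤ ‖Qstar - bellmanOpt p c γ (Qs k)‖ + ‖bellmanOpt p c γ (Qs k) - Qs (k + 1)‖ :=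
      norm_sub_le_norm_sub_add_norm_sub _ _ _
    _ ≤ γ * ‖Qstar - Qs k‖ + ε := by
      have := norm_bellmanOpt_sub_le hp hpsum c hγ₀.le Qstar (Qs k)
      rw [hQstar] at this
      exact add_le_add this (hε k hk)
  have hK_bound : ‖Qstar - Qs K‖ ≤ γ ^ K * ‖Qstar - Qs 0‖ + ε / (1 - γ) :=
    le_pow_mul_add_div_of_le_mul_add (e := fun k => ‖Qstar - Qs k‖) hγ₀.le hγ₁ hε₀ hstep K le_rfl
  have hpolicy : ‖QpiK - bellmanOpt p c γ (Qs K)‖ ≤ γ * ‖QpiK - Qs K‖ := by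
    have := norm_bellmanEval_sub_le hp hpsum c hγ₀.le πK QpiK (Qs K)
    rwa [hQpiK, bellmanEval_eq_bellmanOpt_of_greedy p c γ hgreedyK] at this
  have hopt : ‖bellmanOpt p c γ (Qs K) - Qstar‖ ≤ γ * ‖Qstar - Qs K‖ := by
    have := norm_bellmanOpt_sub_le hp hpsum c hγ₀.le (Qs K) Qstar
    rwa [hQstar, norm_sub_rev (Qs K)] at this
  have htri := norm_sub_le_norm_sub_add_norm_sub QpiK (bellmanOpt p c γ (Qs K)) Qstar
  have htri' := mul_le_mul_of_nonneg_left
    (norm_sub_le_norm_sub_add_norm_sub QpiK Qstar (Qs K)) hγ₀.le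
  have hgreedy : ‖QpiK - Qstar‖ ≤ 2 * γ / (1 - γ) * ‖Qstar - Qs K‖ := by
    rw [div_mul_eq_mul_div, le_div_iff₀ h₁]
    linarith
  calc ‖QpiK - Qstar‖ ≤ 2 * γ / (1 - γ) * ‖Qstar - Qs K‖ := hgreedy
    _ ≤ 2 * γ / (1 - γ) * (γ ^ K * ‖Qstar - Qs 0‖ + ε / (1 - γ)) := by gcongr
    _ = _ := by
      field_simp
      ring
end
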